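/- On a finite probability space with filtration (F_t)_{t=0}^T where F_0 is trivial, let (V_t)_{t=0}^T be an adapted sequence of set-valued maps with nonempty relatively open convex values in ℝ^d. Define recursively W_T = cl V_T and W_t = cl(V_t ∩ ri(conv K(W_{t+1}, F_t))) for 0 ≤ t ≤ T−1, where K(G, F_t)(ω) is the union over ω' in the F_t-atom of ω of G(ω'). Then the martingale selection problem for (V_t) is solvable (i.e., there exist an adapted process ξ with ξ_t ∈ V_t a.s. and a probability measure Q equivalent to P such that ξ is a Q-martingale) if and only if all W_t(ω) are nonempty for all t and ω. -/

import Mathlib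

open Finset Pointwise RealInnerProductSpace

noncomputable section

abbrev E (d : ℕ) : Type := EuclideanSpace ℝ (Fin d)

section RelInt

variable {F : Type*} [NormedAddCommGroup F] [NormedSpace ℝ F]

/-- Relatively open with respect to some ambient affine subspace. -/
def RelOpen (R : Set F) : Prop :=
  ∃ S : AffineSubspace ℝ F, R ⊆ S ∧ ∀ x ∈ R, ∃ ε > 0, ∀ y ∈ S, dist y x < ε → y ∈ R

lemma mem_ri_iff {s : Set F} {x : F} :
    x ∈ intrinsicInterior ℝ s ↔
      x ∈ s ∧ ∃ ε > 0, ∀ y ∈ affineSpan ℝ s, dist y x < ε → y ∈ s := by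
  rw [mem_intrinsicInterior]
  constructor
  · rintro ⟨y, hy, rfl⟩
    refine ⟨by simpa using interior_subset hy, ?_⟩
    rw [mem_interior_iff_mem_nhds, Metric.mem_nhds_iff] at hy
    obtain ⟨ε, hε, hb⟩ := hy
    exact ⟨ε, hε, fun z hz hd => hb (show (⟨z, hz⟩ : affineSpan ℝ s) ∈ Metric.ball y ε from hd)⟩
  · rintro ⟨hx, ε, hε, hb⟩
    refine ⟨⟨x, subset_affineSpan ℝ s hx⟩, ?_, rfl⟩
    rw [mem_interior_iff_mem_nhds, Metric.mem_nhds_iff]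
    exact ⟨ε, hε, fun z hz => hb z z.2 hz⟩

lemma relOpen_ri (s : Set F) : RelOpen (intrinsicInterior ℝ s) := by
  refine ⟨affineSpan ℝ s, fun x hx => subset_affineSpan ℝ s (intrinsicInterior_subset hx), ?_⟩
  intro x hx
  obtain ⟨hxs, ε, hε, hb⟩ := mem_ri_iff.1 hx
  refine ⟨ε / 2, by positivity, fun y hy hd => mem_ri_iff.2 ⟨hb y hy (by linarith), ε / 2,
    by positivity, fun z hz hzd => hb z hz ?_⟩⟩
  linarith [dist_triangle z y x]

lemma RelOpen.inter {A B : Set F} (hA : RelOpen A) (hB : RelOpen B) : RelOpen (A ∩ B) := by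
  obtain ⟨S, hS, h1⟩ := hA
  obtain ⟨S', hS', h2⟩ := hB
  refine ⟨S ⊓ S', fun x hx => ⟨hS hx.1, hS' hx.2⟩, ?_⟩
  rintro x ⟨hxA, hxB⟩
  obtain ⟨e, he, h⟩ := h1 x hxA
  obtain ⟨e', he', h'⟩ := h2 x hxB
  refine ⟨min e e', lt_min he he', fun y hy hd => ?_⟩
  exact ⟨h y hy.1 (hd.trans_le (min_le_left _ _)), h' y hy.2 (hd.trans_le (min_le_right _ _))⟩

lemma aff_comb (S : AffineSubspace ℝ F) {x y z : F} (hx : x ∈ S) (hy : y ∈ S) (hz : z ∈ S)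
    (c : ℝ) : x + c • (y - z) ∈ S := by
  have := S.smul_vsub_vadd_mem c hy hz hx
  simpa [add_comm] using this

/-- Segment from the relative interior to a point of the set. -/
lemma ri_segment {C : Set F} (hC : Convex ℝ C) {z w : F} (hz : z ∈ intrinsicInterior ℝ C)
    (hw : w ∈ C) {a b : ℝ} (ha : 0 < a) (hb : 0 ≤ b) (hab : a + b = 1) :
    a • z + b • w ∈ intrinsicInterior ℝ C := by
  obtain ⟨hzC, ε, hε, hball⟩ := mem_ri_iff.1 hz
  have hx : a • z + b • w ∈ C := hC hzC hw ha.le hb hab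
  refine mem_ri_iff.2 ⟨hx, a * ε, by positivity, fun y hy hd => ?_⟩
  have hz' : z + a⁻¹ • (y - (a • z + b • w)) ∈ C := by
    apply hball
    · exact aff_comb _ (subset_affineSpan ℝ C hzC) hy (subset_affineSpan ℝ C hx) _
    · rw [dist_eq_norm, add_sub_cancel_left, norm_smul, norm_inv, Real.norm_of_nonneg ha.le,
        ← dist_eq_norm]
      rw [inv_mul_lt_iff₀ ha]; exact hd
  have := hC hz' hw ha.le hb hab
  convert this using 1
  rw [smul_add, smul_smul, mul_inv_cancel₀ ha.ne']
  module

lemma convex_ri {C : Set F} (hC : Convex ℝ C) : Convex ℝ (intrinsicInterior ℝ C) := by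
  intro x hx y hy a b ha hb hab
  rcases ha.eq_or_lt with rfl | ha
  · have : b = 1 := by linarith
    simpa [this] using hy
  · exact ri_segment hC hx (intrinsicInterior_subset hy) ha hb hab

variable [FiniteDimensional ℝ F]

lemma ri_of_alg {C : Set F} (hC : Convex ℝ C) {x : F} (hx : x ∈ C)
    (h : ∀ y ∈ C, ∃ ε > (0 : ℝ), x + ε • (x - y) ∈ C) : x ∈ intrinsicInterior ℝ C := by
  obtain ⟨z, hz⟩ := Set.Nonempty.intrinsicInterior hC ⟨x, hx⟩
  obtain ⟨ε, hε, hw⟩ := h z (intrinsicInterior_subset hz)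
  have := ri_segment hC hz hw (a := ε / (1 + ε)) (b := 1 / (1 + ε)) (by positivity)
    (by positivity) (by field_simp; ring)
  convert this using 1
  match_scalars <;> field_simp <;> ring

lemma alg_of_ri {C : Set F} {x y : F} (hx : x ∈ intrinsicInterior ℝ C) (hy : y ∈ C) :
    ∃ ε > (0 : ℝ), x + ε • (x - y) ∈ C := by
  obtain ⟨hxC, ε, hε, hball⟩ := mem_ri_iff.1 hx
  have hpos : 0 < 1 + ‖x - y‖ := by positivity
  refine ⟨ε / (1 + ‖x - y‖), by positivity, hball _ ?_ ?_⟩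
  · exact aff_comb _ (subset_affineSpan ℝ C hxC) (subset_affineSpan ℝ C hxC)
      (subset_affineSpan ℝ C hy) _
  · rw [dist_eq_norm, add_sub_cancel_left, norm_smul, Real.norm_of_nonneg (by positivity),
      div_mul_eq_mul_div, div_lt_iff₀ hpos]
    nlinarith

lemma RelOpen.extend {R : Set F} (hR : RelOpen R) {x y : F} (hx : x ∈ R) (hy : y ∈ closure R) :
    ∃ ε > (0 : ℝ), x + ε • (x - y) ∈ R := by
  obtain ⟨S, hS, h⟩ := hR
  obtain ⟨ε, hε, hball⟩ := h x hx
  have hyS : y ∈ S := closure_minimal hS S.closed_of_finiteDimensional hy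
  have hpos : 0 < 1 + ‖x - y‖ := by positivity
  refine ⟨ε / (1 + ‖x - y‖), by positivity, hball _ ?_ ?_⟩
  · exact aff_comb _ (hS hx) (hS hx) hyS _
  · rw [dist_eq_norm, add_sub_cancel_left, norm_smul, Real.norm_of_nonneg (by positivity),
      div_mul_eq_mul_div, div_lt_iff₀ hpos]
    nlinarith

lemma RelOpen.segment {R : Set F} (hR : RelOpen R) (hc : Convex ℝ R) {x w : F} (hx : x ∈ R)
    (hw : w ∈ closure R) {a b : ℝ} (ha : 0 < a) (hb : 0 ≤ b) (hab : a + b = 1) :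
    a • x + b • w ∈ R := by
  obtain ⟨S, hS, h⟩ := hR
  obtain ⟨ε, hε, hball⟩ := h x hx
  have hwS : w ∈ S := closure_minimal hS S.closed_of_finiteDimensional hw
  obtain ⟨w', hw', hd⟩ := Metric.mem_closure_iff.1 hw (ε * a / (1 + b)) (by positivity)
  have hx' : x + (b / a) • (w - w') ∈ R := by
    apply hball
    · exact aff_comb _ (hS hx) hwS (hS hw') _
    · rw [dist_eq_norm, add_sub_cancel_left, norm_smul, Real.norm_of_nonneg (by positivity),
        div_mul_eq_mul_div, div_lt_iff₀ ha, ← dist_eq_norm]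
      rw [lt_div_iff₀ (by positivity)] at hd
      nlinarith [dist_nonneg (x := w) (y := w')]
  have := hc hx' hw' ha.le hb hab
  convert this using 1
  rw [smul_add, smul_smul, mul_div_cancel₀ _ ha.ne']
  module

/-- combos with strictly positive weights -/
def PosComb {ι : Type*} (A : Finset ι) (R : ι → Set F) : Set F :=
  {x | ∃ (l : ι → ℝ) (v : ι → F), (∀ i ∈ A, 0 < l i) ∧ ∑ i ∈ A, l i = 1 ∧ (∀ i ∈ A, v i ∈ R i) ∧
    ∑ i ∈ A, l i • v i = x}

variable {ι : Type*} [DecidableEq ι] {A : Finset ι} {R : ι → Set F}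

lemma PosComb.convex (hc : ∀ i ∈ A, Convex ℝ (R i)) : Convex ℝ (PosComb A R) := by
  rintro _ ⟨l, v, hl, hl1, hv, rfl⟩ _ ⟨m, w, hm, hm1, hw, rfl⟩ a b ha hb hab
  have hpos : ∀ i ∈ A, 0 < a * l i + b * m i := by
    intro i hi
    have h1 := hl i hi
    have h2 := hm i hi
    rcases ha.eq_or_lt with rfl | ha
    · have : b = 1 := by linarith
      simp [this, h2]
    · positivity
  refine ⟨fun i => a * l i + b * m i, fun i => (a * l i / (a * l i + b * m i)) • v i +
    (b * m i / (a * l i + b * m i)) • w i, hpos, ?_, ?_, ?_⟩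
  · simp [Finset.sum_add_distrib, ← Finset.mul_sum, hl1, hm1, hab]
  · intro i hi
    have h1 := hl i hi
    have h2 := hm i hi
    have h3 := hpos i hi
    exact hc i hi (hv i hi) (hw i hi) (by positivity) (by positivity) (by field_simp)
  · rw [Finset.smul_sum, Finset.smul_sum, ← Finset.sum_add_distrib]
    refine Finset.sum_congr rfl fun i hi => ?_
    have h3 := (hpos i hi).ne'
    simp only [smul_add, smul_smul]
    rw [mul_div_cancel₀ _ h3, mul_div_cancel₀ _ h3]

lemma ri_subset_posComb (hA : A.Nonempty) (hne : ∀ i ∈ A, (R i).Nonempty)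
    (hc : ∀ i ∈ A, Convex ℝ (R i)) (hR : ∀ i ∈ A, RelOpen (R i)) :
    intrinsicInterior ℝ (convexHull ℝ (⋃ i ∈ A, closure (R i))) ⊆ PosComb A R := by
  intro x hx
  have hD := PosComb.convex hc
  -- the absorbing property
  have key : convexHull ℝ (⋃ i ∈ A, closure (R i)) ⊆
      {w | ∀ d ∈ PosComb A R, ∀ a b : ℝ, 0 < a → 0 < b → a + b = 1 →
        a • d + b • w ∈ PosComb A R} := by
    apply convexHull_min
    · intro w hw
      simp only [Set.mem_iUnion] at hw
      obtain ⟨i, hi, hw⟩ := hw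
      rintro _ ⟨l, v, hl, hl1, hv, rfl⟩ a b ha hb hab
      have hli := hl i hi
      have hp : 0 < a * l i + b := by positivity
      refine ⟨fun j => a * l j + if j = i then b else 0,
        fun j => if j = i then (a * l i / (a * l i + b)) • v i + (b / (a * l i + b)) • w else v j,
        ?_, ?_, ?_, ?_⟩
      · intro j hj
        have := hl j hj
        dsimp only
        split_ifs <;> positivity
      · simp [Finset.sum_add_distrib, ← Finset.mul_sum, hl1, hab, hi]
      · intro j hj
        dsimp only
        split_ifs with h
        · subst h
          exact (hR j hj).segment (hc j hj) (hv j hj) hw (by positivity) (by positivity)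
            (by field_simp)
        · exact hv j hj
      · have : ∀ j ∈ A, ((a * l j + if j = i then b else 0) •
            (if j = i then (a * l i / (a * l i + b)) • v i + (b / (a * l i + b)) • w else v j))
            = a • l j • v j + if j = i then b • w else 0 := by
          intro j hj
          split_ifs with h
          · subst h
            simp only [smul_add, smul_smul]
            rw [mul_div_cancel₀ _ hp.ne', mul_div_cancel₀ _ hp.ne']
          · simp [smul_smul]
        rw [Finset.sum_congr rfl this, Finset.sum_add_distrib, ← Finset.smul_sum]
        simp [hi]
    · intro w hw w' hw' α β hα hβ hαβ d hd a b ha hb hab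
      have := hD (hw d hd a b ha hb hab) (hw' d hd a b ha hb hab) hα hβ hαβ
      convert this using 1
      have : d = (α + β) • d := by rw [hαβ, one_smul]
      nth_rw 1 [this]
      module
  -- a point of D
  choose! v hv using hne
  have hcard : (0 : ℝ) < A.card := by exact_mod_cast hA.card_pos
  have hd : ∑ i ∈ A, (A.card : ℝ)⁻¹ • v i ∈ PosComb A R :=
    ⟨fun _ => (A.card : ℝ)⁻¹, v, fun _ _ => by positivity, by simp [hcard.ne'], hv, rfl⟩
  set d := ∑ i ∈ A, (A.card : ℝ)⁻¹ • v i
  have hdC : d ∈ convexHull ℝ (⋃ i ∈ A, closure (R i)) := by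
    refine (convex_convexHull ℝ _).sum_mem (fun _ _ => by positivity) (by simp [hcard.ne']) ?_
    intro i hi
    exact subset_convexHull ℝ _ (Set.mem_biUnion hi (subset_closure (hv i hi)))
  obtain ⟨ε, hε, hw⟩ := alg_of_ri hx hdC
  have := key hw d hd (ε / (1 + ε)) (1 / (1 + ε)) (by positivity) (by positivity)
    (by field_simp; ring)
  convert this using 1
  match_scalars <;> field_simp <;> ring

lemma posComb_subset_ri (hR : ∀ i ∈ A, RelOpen (R i)) :
    PosComb A R ⊆ intrinsicInterior ℝ (convexHull ℝ (⋃ i ∈ A, closure (R i))) := by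
  rintro x ⟨l, v, hl, hl1, hv, rfl⟩
  set C := convexHull ℝ (⋃ i ∈ A, closure (R i)) with hCdef
  have hC : Convex ℝ C := convex_convexHull ℝ _
  have hin : ∀ i ∈ A, R i ⊆ C := fun i hi y hy =>
    subset_convexHull ℝ _ (Set.mem_biUnion hi (subset_closure hy))
  set x := ∑ i ∈ A, l i • v i with hxdef
  have hx : x ∈ C := hC.sum_mem (fun i hi => (hl i hi).le) hl1 (fun i hi => hin i hi (hv i hi))
  -- shrink
  have shrink : ∀ (u : F) (e e' : ℝ), 0 < e' → e' ≤ e → x + e • u ∈ C → x + e' • u ∈ C := by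
    intro u e e' he' hle h
    have he : 0 < e := he'.trans_le hle
    have := hC hx h (a := 1 - e' / e) (b := e' / e) (by rw [sub_nonneg, div_le_one he]; exact hle)
      (by positivity) (by ring)
    convert this using 1
    match_scalars <;> field_simp <;> ring
  have cone : ∀ (u w : F) (e e' a b : ℝ), 0 < e → 0 < e' → 0 ≤ a → 0 ≤ b → a + b = 1 →
      x + e • u ∈ C → x + e' • w ∈ C → ∃ ε > (0 : ℝ), x + ε • (a • u + b • w) ∈ C := by
    intro u w e e' a b he he' ha hb hab h h'
    refine ⟨min e e', lt_min he he', ?_⟩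
    have h1 := shrink u e (min e e') (lt_min he he') (min_le_left _ _) h
    have h2 := shrink w e' (min e e') (lt_min he he') (min_le_right _ _) h'
    have := hC h1 h2 ha hb hab
    convert this using 1
    have : x = (a + b) • x := by rw [hab, one_smul]
    nth_rw 1 [this]
    module
  have key : C ⊆ {y | ∃ ε > (0 : ℝ), x + ε • (x - y) ∈ C} := by
    apply convexHull_min
    · intro y hy
      simp only [Set.mem_iUnion] at hy
      obtain ⟨i, hi, hy⟩ := hy
      have hli := hl i hi
      obtain ⟨δ, hδ, hz⟩ := (hR i hi).extend (hv i hi) hy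
      have h1 : x + l i • (x - v i) ∈ C := by
        have := hC.sum_mem (t := A) (w := fun j => (1 + l i) * l j - if j = i then l i else 0)
          (z := v) ?_ ?_ (fun j hj => hin j hj (hv j hj))
        · convert this using 1
          simp only [sub_smul, Finset.sum_sub_distrib, mul_smul, ← Finset.smul_sum, ← hxdef,
            ite_smul, zero_smul, Finset.sum_ite_eq', hi, if_true]
          module
        · intro j hj
          have := hl j hj
          split_ifs with h
          · subst h; nlinarith
          · simp only [sub_zero]; positivity
        · simp [Finset.sum_sub_distrib, ← Finset.mul_sum, hl1, hi]
      have h2 : x + (l i * δ) • (v i - y) ∈ C := by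
        have := hC.sum_mem (t := A) (w := l)
          (z := fun j => v j + if j = i then δ • (v i - y) else 0) (fun j hj => (hl j hj).le) hl1 ?_
        · convert this using 1
          simp [smul_add, Finset.sum_add_distrib, hi, ← hxdef, smul_smul]
        · intro j hj
          split_ifs with h
          · subst h; exact hin j hj hz
          · simpa using hin j hj (hv j hj)
      obtain ⟨ε, hε, h⟩ := cone _ _ _ _ (1/2) (1/2) hli (mul_pos hli hδ) (by norm_num)
        (by norm_num) (by norm_num) h1 h2
      refine ⟨ε / 2, by positivity, ?_⟩
      convert h using 1
      module
    · rintro y ⟨e, he, h⟩ y' ⟨e', he', h'⟩ a b ha hb hab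
      obtain ⟨ε, hε, h⟩ := cone _ _ _ _ a b he he' ha hb hab h h'
      refine ⟨ε, hε, ?_⟩
      convert h using 1
      have : x = (a + b) • x := by rw [hab, one_smul]
      nth_rw 2 [this]
      module
  exact ri_of_alg hC hx key

end RelInt

section Step

variable {Ω : Type} {F : Type*} [NormedAddCommGroup F] [NormedSpace ℝ F]

lemma swap_sum {M : Type*} [AddCommMonoid M] (A B : Ω → Finset Ω)
    (hmemB : ∀ ω, ω ∈ B ω)
    (hA : ∀ ω ω', ω' ∈ A ω → A ω' = A ω) (hB : ∀ ω ω', ω' ∈ B ω → B ω' = B ω)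
    (hBA : ∀ ω, B ω ⊆ A ω) (ω : Ω) (g : Ω → Ω → M) :
    ∑ x ∈ A ω, ∑ y ∈ B x, g x y = ∑ y ∈ A ω, ∑ x ∈ B y, g x y := by
  apply Finset.sum_comm'
  intro x y
  constructor
  · rintro ⟨hx, hy⟩
    refine ⟨by rw [hB x y hy]; exact hmemB x, ?_⟩
    rw [← hA _ _ hx]; exact hBA _ hy
  · rintro ⟨hx, hy⟩
    refine ⟨?_, by rw [hB y x hx]; exact hmemB y⟩
    rw [← hA _ _ hy]; exact hBA _ hx

/-- One-step construction. -/
lemma one_step [FiniteDimensional ℝ F] [DecidableEq Ω] (A B : Ω → Finset Ω)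
    (hmemA : ∀ ω, ω ∈ A ω) (hmemB : ∀ ω, ω ∈ B ω)
    (hA : ∀ ω ω', ω' ∈ A ω → A ω' = A ω) (hB : ∀ ω ω', ω' ∈ B ω → B ω' = B ω)
    (hBA : ∀ ω, B ω ⊆ A ω) (R : Ω → Set F) (hne : ∀ ω, (R ω).Nonempty)
    (hc : ∀ ω, Convex ℝ (R ω)) (hR : ∀ ω, RelOpen (R ω))
    (hRB : ∀ ω ω', ω' ∈ B ω → R ω' = R ω) (x : Ω → F)
    (hxA : ∀ ω ω', ω' ∈ A ω → x ω' = x ω)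
    (hx : ∀ ω, x ω ∈ intrinsicInterior ℝ (convexHull ℝ (⋃ ω' ∈ A ω, closure (R ω')))) :
    ∃ (l : Ω → ℝ) (y : Ω → F), (∀ ω, 0 < l ω) ∧ (∀ ω, ∑ ω' ∈ A ω, l ω' = 1) ∧
      (∀ ω, y ω ∈ R ω) ∧ (∀ ω ω', ω' ∈ B ω → y ω' = y ω) ∧
      ∀ ω, ∑ ω' ∈ A ω, l ω' • y ω' = x ω := by
  have h1 : ∀ ω, x ω ∈ PosComb (A ω) R := fun ω =>
    ri_subset_posComb ⟨ω, hmemA ω⟩ (fun i _ => hne i) (fun i _ => hc i) (fun i _ => hR i) (hx ω)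
  choose L X hL hL1 hX hLX using h1
  -- representatives
  obtain ⟨rep, hrep, hrepA⟩ : ∃ rep : Ω → Ω, (∀ ω, rep ω ∈ A ω) ∧
      ∀ ω ω', ω' ∈ A ω → rep ω' = rep ω := by
    have : ∀ s : Finset Ω, ∃ r : Ω → Ω, ∀ ω ∈ s, r ω ∈ s ∧ ∀ ω' ∈ s, r ω' = r ω := by
      intro s
      rcases s.eq_empty_or_nonempty with rfl | ⟨a, ha⟩
      · exact ⟨id, by simp⟩
      · exact ⟨fun _ => a, fun _ _ => ⟨ha, fun _ _ => rfl⟩⟩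
    choose r hr using this
    refine ⟨fun ω => r (A ω) ω, fun ω => (hr _ ω (hmemA ω)).1, fun ω ω' h => ?_⟩
    simp only [hA ω ω' h]
    exact (hr _ ω (hmemA ω)).2 _ h
  have hrA : ∀ ω, A (rep ω) = A ω := fun ω => hA _ _ (hrep ω)
  set l : Ω → ℝ := fun ω => L (rep ω) ω with hl
  set v : Ω → F := fun ω => X (rep ω) ω with hv
  have hlpos : ∀ ω, 0 < l ω := fun ω => hL (rep ω) ω (by rw [hrA]; exact hmemA ω)
  have hvR : ∀ ω, v ω ∈ R ω := fun ω => hX (rep ω) ω (by rw [hrA]; exact hmemA ω)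
  have hl1 : ∀ ω, ∑ ω' ∈ A ω, l ω' = 1 := by
    intro ω
    rw [← hL1 (rep ω), hrA]
    exact Finset.sum_congr rfl fun i hi => by simp only [hl, hrepA ω i hi]
  have hlv : ∀ ω, ∑ ω' ∈ A ω, l ω' • v ω' = x ω := by
    intro ω
    rw [← hxA ω (rep ω) (hrep ω), ← hLX (rep ω), hrA]
    exact Finset.sum_congr rfl fun i hi => by simp only [hl, hv, hrepA ω i hi]
  have hp : ∀ ω, 0 < ∑ ω' ∈ B ω, l ω' := fun ω =>
    Finset.sum_pos (fun i _ => hlpos i) ⟨ω, hmemB ω⟩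
  refine ⟨l, fun ω => ∑ ω' ∈ B ω, ((∑ z ∈ B ω, l z)⁻¹ * l ω') • v ω', hlpos, hl1, ?_, ?_, ?_⟩
  · intro ω
    refine (hc ω).sum_mem (fun i _ => ?_) ?_ (fun i hi => ?_)
    · have := hlpos i
      have := hp ω
      positivity
    · rw [← Finset.mul_sum, inv_mul_cancel₀ (hp ω).ne']
    · rw [← hRB ω i hi]; exact hvR i
  · intro ω ω' h
    simp only [hB ω ω' h]
  · intro ω
    rw [← hlv ω]
    simp only [Finset.smul_sum]
    rw [swap_sum A B hmemB hA hB hBA]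
    refine Finset.sum_congr rfl fun y hy => ?_
    have : ∀ x ∈ B y, l x • ((∑ z ∈ B x, l z)⁻¹ * l y) • v y
        = (l x * ((∑ z ∈ B y, l z)⁻¹ * l y)) • v y := by
      intro x hx
      rw [hB y x hx, smul_smul]
    rw [Finset.sum_congr rfl this, ← Finset.sum_smul, ← Finset.sum_mul, ← mul_assoc,
      mul_inv_cancel₀ (hp y).ne', one_mul]

end Step

/-- Martingale selection theorem on a finite probability space:
the martingale selection problem for an adapted sequence of nonempty relatively open
convex sets (V_t) is solvable iff the recursively defined sets
W_T = cl V_T, W_t = cl(V_t ∩ ri conv K(W_{t+1}, F_t)) are all nonempty. -/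
theorem martingale_selection_theorem {Ω : Type} [Fintype Ω] [DecidableEq Ω] [Nonempty Ω]
    {d : ℕ} (T : ℕ)
    (P : Ω → ℝ) (hP : ∀ ω, 0 < P ω) (hP1 : ∑ ω, P ω = 1)
    (atom : ℕ → Ω → Finset Ω)
    (hmem : ∀ t ω, ω ∈ atom t ω)
    (hpart : ∀ t ω ω', ω' ∈ atom t ω → atom t ω' = atom t ω)
    (hrefine : ∀ t ω, atom (t + 1) ω ⊆ atom t ω)
    (h0 : ∀ ω, atom 0 ω = Finset.univ)
    (hT : ∀ ω, atom T ω = {ω})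
    (V : ℕ → Ω → Set (E d))
    (hVne : ∀ t ω, (V t ω).Nonempty)
    (hVconv : ∀ t ω, Convex ℝ (V t ω))
    (hVopen : ∀ t ω, intrinsicInterior ℝ (V t ω) = V t ω)
    (hVadapted : ∀ t ω ω', ω' ∈ atom t ω → V t ω' = V t ω)
    (W : ℕ → Ω → Set (E d))
    (hWT : ∀ ω, W T ω = closure (V T ω))
    (hWt : ∀ t, t < T → ∀ ω, W t ω = closure (V t ω ∩
        intrinsicInterior ℝ (convexHull ℝ (⋃ ω' ∈ atom t ω, W (t + 1) ω')))) :
    (∃ (ξ : ℕ → Ω → E d) (Q : Ω → ℝ),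
        (∀ ω, 0 < Q ω) ∧ (∑ ω, Q ω = 1) ∧
        (∀ t ω ω', t ≤ T → ω' ∈ atom t ω → ξ t ω' = ξ t ω) ∧
        (∀ t ω, t ≤ T → ξ t ω ∈ V t ω) ∧
        (∀ t ω, t < T →
          (∑ ω' ∈ atom t ω, Q ω')⁻¹ • ∑ ω' ∈ atom t ω, Q ω' • ξ (t + 1) ω' = ξ t ω))
      ↔ (∀ t ω, t ≤ T → (W t ω).Nonempty) := by
  -- the relatively open sets whose closures are the sets W
  obtain ⟨R, hRT, hRt⟩ : ∃ R : ℕ → Ω → Set (E d), (∀ ω, R T ω = V T ω) ∧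
      ∀ t, t < T → ∀ ω, R t ω = V t ω ∩
        intrinsicInterior ℝ (convexHull ℝ (⋃ ω' ∈ atom t ω, W (t + 1) ω')) := by
    refine ⟨fun t ω => if t = T then V T ω else V t ω ∩
        intrinsicInterior ℝ (convexHull ℝ (⋃ ω' ∈ atom t ω, W (t + 1) ω')), by simp, ?_⟩
    intro t ht ω
    simp [ht.ne]
  have hWR : ∀ t, t ≤ T → ∀ ω, W t ω = closure (R t ω) := by
    intro t ht ω
    rcases ht.eq_or_lt with rfl | ht
    · rw [hWT, hRT]
    · rw [hWt t ht, hRt t ht]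
  have hRs : ∀ t, t < T → ∀ ω, R t ω = V t ω ∩
      intrinsicInterior ℝ (convexHull ℝ (⋃ ω' ∈ atom t ω, closure (R (t + 1) ω'))) := by
    intro t ht ω
    rw [hRt t ht]
    simp only [hWR (t + 1) ht]
  have hVro : ∀ t ω, RelOpen (V t ω) := fun t ω => by
    rw [← hVopen t ω]; exact relOpen_ri _
  have hRro : ∀ t, t ≤ T → ∀ ω, RelOpen (R t ω) := by
    intro t ht ω
    rcases ht.eq_or_lt with rfl | ht
    · rw [hRT]; exact hVro _ _
    · rw [hRt t ht]; exact (hVro _ _).inter (relOpen_ri _)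
  have hRc : ∀ t, t ≤ T → ∀ ω, Convex ℝ (R t ω) := by
    intro t ht ω
    rcases ht.eq_or_lt with rfl | ht
    · rw [hRT]; exact hVconv _ _
    · rw [hRt t ht]; exact (hVconv _ _).inter (convex_ri (convex_convexHull ℝ _))
  have hRV : ∀ t, t ≤ T → ∀ ω, R t ω ⊆ V t ω := by
    intro t ht ω
    rcases ht.eq_or_lt with rfl | ht
    · rw [hRT]
    · rw [hRt t ht]; exact Set.inter_subset_left
  have hRad : ∀ t, t ≤ T → ∀ ω ω', ω' ∈ atom t ω → R t ω' = R t ω := by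
    intro t ht ω ω' h
    rcases ht.eq_or_lt with rfl | ht
    · rw [hRT, hRT, hVadapted _ _ _ h]
    · rw [hRt t ht, hRt t ht, hVadapted _ _ _ h, hpart _ _ _ h]
  constructor
  · rintro ⟨ξ, Q, hQ, -, had, hV, hmart⟩
    have key : ∀ k, k ≤ T → ∀ ω, ξ (T - k) ω ∈ R (T - k) ω := by
      intro k
      induction k with
      | zero => intro _ ω; rw [Nat.sub_zero, hRT]; exact hV T ω le_rfl
      | succ k ih =>
        intro hk ω
        have hlt : T - (k + 1) < T := by omega
        have he : T - (k + 1) + 1 = T - k := by omega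
        have ih := ih (by omega)
        rw [← he] at ih
        rw [hRs _ hlt]
        refine ⟨hV _ _ hlt.le, ?_⟩
        apply posComb_subset_ri (fun i _ => hRro _ hlt i)
        have hp : 0 < ∑ ω' ∈ atom (T - (k + 1)) ω, Q ω' :=
          Finset.sum_pos (fun i _ => hQ i) ⟨ω, hmem _ _⟩
        refine ⟨fun i => (∑ ω' ∈ atom (T - (k + 1)) ω, Q ω')⁻¹ * Q i, ξ (T - (k + 1) + 1), ?_, ?_,
          fun i _ => ih i, ?_⟩
        · intro i _
          have := hQ i
          positivity
        · rw [← Finset.mul_sum, inv_mul_cancel₀ hp.ne']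
        · rw [← hmart _ ω hlt, Finset.smul_sum]
          simp only [smul_smul]
    intro t ω ht
    rw [hWR t ht]
    have := key (T - t) (by omega) ω
    rw [show T - (T - t) = t by omega] at this
    exact ⟨_, subset_closure this⟩
  · intro hW
    have hRne : ∀ t, t ≤ T → ∀ ω, (R t ω).Nonempty := by
      intro t ht ω
      have := hW t ω ht
      rw [hWR t ht] at this
      exact closure_nonempty_iff.1 this
    have hmono : ∀ s t, s ≤ t → ∀ ω, atom t ω ⊆ atom s ω := by
      intro s t hst
      induction hst with
      | refl => exact fun _ => subset_rfl
      | step _ ih => exact fun ω => (hrefine _ ω).trans (ih ω)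
    have key : ∀ k, k ≤ T → ∀ x : Ω → E d, (∀ ω, x ω ∈ R (T - k) ω) →
        (∀ ω ω', ω' ∈ atom (T - k) ω → x ω' = x ω) →
        ∃ (ξ : ℕ → Ω → E d) (q : Ω → ℝ), (∀ ω, 0 < q ω) ∧
          (∀ ω, ∑ ω' ∈ atom (T - k) ω, q ω' = 1) ∧ ξ (T - k) = x ∧
          (∀ s ω ω', T - k ≤ s → s ≤ T → ω' ∈ atom s ω → ξ s ω' = ξ s ω) ∧
          (∀ s ω, T - k ≤ s → s ≤ T → ξ s ω ∈ V s ω) ∧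
          (∀ s ω, T - k ≤ s → s < T →
            ∑ ω' ∈ atom s ω, q ω' • ξ (s + 1) ω' = (∑ ω' ∈ atom s ω, q ω') • ξ s ω) := by
      intro k
      induction k with
      | zero =>
        intro _ x hx hxa
        refine ⟨fun _ => x, fun _ => 1, fun _ => one_pos, ?_, rfl, ?_, ?_, ?_⟩
        · intro ω; simp [hT]
        · intro s ω ω' h1 h2
          obtain rfl : s = T := by omega
          exact hxa ω ω'
        · intro s ω h1 h2
          obtain rfl : s = T := by omega
          exact hRV _ le_rfl _ (hx ω)
        · intro s ω h1 h2; omega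
      | succ k ih =>
        intro hk x hx hxa
        have ih := ih (by omega)
        obtain ⟨t, ht⟩ : ∃ t, t = T - (k + 1) := ⟨_, rfl⟩
        have he : T - k = t + 1 := by omega
        have hlt : t < T := by omega
        rw [← ht] at hx hxa ⊢
        rw [he] at ih
        obtain ⟨l, y, hl, hl1, hyR, hyB, hly⟩ := one_step (atom t) (atom (t + 1)) (hmem t)
          (hmem (t + 1)) (hpart t) (hpart (t + 1)) (hrefine t) (R (t + 1)) (hRne _ hlt)
          (hRc _ hlt) (hRro _ hlt) (hRad _ hlt) x hxa
          (fun ω => by have := hx ω; rw [hRs t hlt] at this; exact this.2)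
        obtain ⟨ξ, q, hq, hq1, hξ, had, hV, hm⟩ := ih y hyR hyB
        have hp : ∀ ω, 0 < ∑ ω' ∈ atom (t + 1) ω, l ω' := fun ω =>
          Finset.sum_pos (fun i _ => hl i) ⟨ω, hmem _ ω⟩
        have hswap := swap_sum (M := ℝ) (atom t) (atom (t + 1)) (hmem (t + 1)) (hpart t)
          (hpart (t + 1)) (hrefine t)
        have hswapE := swap_sum (M := E d) (atom t) (atom (t + 1)) (hmem (t + 1)) (hpart t)
          (hpart (t + 1)) (hrefine t)
        have hsum1 : ∀ ω, ∑ ω' ∈ atom t ω, q ω' * ∑ z ∈ atom (t + 1) ω', l z = 1 := by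
          intro ω
          simp only [Finset.mul_sum]
          rw [hswap]
          simp only [← Finset.sum_mul, hq1, one_mul, hl1]
        refine ⟨Function.update ξ t x, fun ω => q ω * ∑ z ∈ atom (t + 1) ω, l z,
          fun ω => mul_pos (hq ω) (hp ω), hsum1, by simp, ?_, ?_, ?_⟩
        · intro s ω ω' h1 h2 h
          rcases h1.eq_or_lt with rfl | h1
          · simpa using hxa _ _ h
          · simpa [Function.update_of_ne h1.ne'] using had s ω ω' h1 h2 h
        · intro s ω h1 h2
          rcases h1.eq_or_lt with rfl | h1
          · simpa using hRV _ h2 _ (hx ω)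
          · simpa [Function.update_of_ne h1.ne'] using hV s ω h1 h2
        · intro s ω h1 h2
          rcases h1.eq_or_lt with rfl | h1
          · rw [hsum1, one_smul, Function.update_self,
              Function.update_of_ne (Nat.succ_ne_self t), hξ, ← hly ω]
            simp only [Finset.mul_sum, Finset.sum_smul]
            rw [hswapE]
            refine Finset.sum_congr rfl fun b _ => ?_
            have : ∀ a ∈ atom (t + 1) b, (q a * l b) • y a = q a • (l b • y b) := by
              intro a ha
              rw [hyB b a ha, smul_smul]
            rw [Finset.sum_congr rfl this, ← Finset.sum_smul, hq1, one_smul]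
          · have hconst : ∀ a ∈ atom s ω, ∑ z ∈ atom (t + 1) a, l z
                = ∑ z ∈ atom (t + 1) ω, l z := by
              intro a ha
              rw [hpart (t + 1) ω a (hmono (t + 1) s h1 ω ha)]
            rw [Function.update_of_ne h1.ne', Function.update_of_ne (by omega : s + 1 ≠ t)]
            have e1 : ∑ a ∈ atom s ω, (q a * ∑ z ∈ atom (t + 1) a, l z) • ξ (s + 1) a
                = (∑ z ∈ atom (t + 1) ω, l z) • ∑ a ∈ atom s ω, q a • ξ (s + 1) a := by
              rw [Finset.smul_sum]
              refine Finset.sum_congr rfl fun a ha => ?_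
              rw [hconst a ha, smul_smul, mul_comm]
            have e2 : ∑ a ∈ atom s ω, (q a * ∑ z ∈ atom (t + 1) a, l z)
                = (∑ z ∈ atom (t + 1) ω, l z) * ∑ a ∈ atom s ω, q a := by
              rw [Finset.mul_sum]
              refine Finset.sum_congr rfl fun a ha => ?_
              rw [hconst a ha, mul_comm]
            rw [e1, e2, hm s ω h1 h2, smul_smul]
    obtain ⟨ω₀⟩ := ‹Nonempty Ω›
    obtain ⟨x₀, hx₀⟩ := hRne 0 (Nat.zero_le _) ω₀
    have hz : T - T = 0 := by omega
    have key0 := key T le_rfl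
    rw [hz] at key0
    obtain ⟨ξ, q, hq, hq1, -, had, hV, hm⟩ := key0 (fun _ => x₀)
      (fun ω => by rw [hRad 0 (Nat.zero_le _) ω₀ ω (by simp [h0])]; exact hx₀)
      (fun _ _ _ => rfl)
    refine ⟨ξ, q, hq, by simpa [h0] using hq1 ω₀, fun t ω ω' => had t ω ω' (Nat.zero_le _),
      fun t ω => hV t ω (Nat.zero_le _), fun t ω ht => ?_⟩
    have hp : 0 < ∑ ω' ∈ atom t ω, q ω' := Finset.sum_pos (fun i _ => hq i) ⟨ω, hmem _ ω⟩
    rw [hm t ω (Nat.zero_le _) ht, smul_smul, inv_mul_cancel₀ hp.ne', one_smul]
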